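/- In the finite setting, the triple minimization ∑_x p(x) ∑_t p(t|x) log(p(t|x)/q(t)) - β ∑_x p(x) ∑_t p(t|x) ∑_y p(y|x) log r(y|t), minimized over conditional pmfs p(t|x), pmfs q(t), and conditional pmfs r(y|t), equals the double minimization over q and r of F(q,r) = -∑_x p(x) log(∑_t q(t) exp(β ∑_y p(y|x) log r(y|t))). -/

import Mathlib

open Finset

/-- Gibbs' variational inequality on a finite set. -/
theorem neg_log_sum_le_sum_mul_log_div {T : Type*} [Fintype T] {a w : T → ℝ}
    (ha : ∀ t, 0 < a t) (ha1 : ∑ t, a t = 1) (hw : ∀ t, 0 < w t) :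
    -Real.log (∑ t, w t) ≤ ∑ t, a t * Real.log (a t / w t) := by
  have hT : (univ : Finset T).Nonempty := by
    by_contra h
    simp [not_nonempty_iff_eq_empty.mp h] at ha1
  have hZ : 0 < ∑ t, w t := sum_pos (fun t _ => hw t) hT
  have key : ∀ t, a t - w t / (∑ s, w s) - a t * Real.log (∑ s, w s)
      ≤ a t * Real.log (a t / w t) := by
    intro t
    have hat := ha t
    have hwt := hw t
    have h := Real.log_le_sub_one_of_pos (x := w t / (a t * ∑ s, w s)) (by positivity)
    rw [Real.log_div hwt.ne' (by positivity), Real.log_mul hat.ne' hZ.ne'] at h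
    rw [Real.log_div hat.ne' hwt.ne']
    have h' := mul_le_mul_of_nonneg_left h hat.le
    have e : a t * (w t / (a t * ∑ s, w s) - 1) = w t / (∑ s, w s) - a t := by
      field_simp
    rw [e] at h'
    linarith
  have hsum := sum_le_sum fun t (_ : t ∈ univ) => key t
  rw [sum_sub_distrib, sum_sub_distrib, ← sum_div, ← sum_mul, ha1, div_self hZ.ne'] at hsum
  linarith

/-- The normalized weights attain equality in Gibbs' variational inequality. -/
theorem sum_normalized_mul_log_div {T : Type*} [Fintype T] [Nonempty T] {w : T → ℝ}
    (hw : ∀ t, 0 < w t) :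
    ∑ t, w t / (∑ s, w s) * Real.log (w t / (∑ s, w s) / w t) = -Real.log (∑ t, w t) := by
  have hZ : 0 < ∑ t, w t := sum_pos (fun t _ => hw t) univ_nonempty
  have h : ∀ t, w t / (∑ s, w s) / w t = (∑ s, w s)⁻¹ := by
    intro t
    have := (hw t).ne'
    field_simp
  simp only [h, Real.log_inv]
  rw [← sum_mul, ← sum_div, div_self hZ.ne', one_mul]

/-- The Lagrangian as an average of relative entropies with respect to tilted weights. -/
theorem sum_mul_log_sub_eq_sum_mul_log_div_mul_exp {X T : Type*} [Fintype X] [Fintype T]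
    (p : X → ℝ) (β : ℝ) {a : X → T → ℝ} {q : T → ℝ} (S : X → T → ℝ)
    (ha : ∀ x t, 0 < a x t) (hq : ∀ t, 0 < q t) :
    (∑ x, p x * ∑ t, a x t * Real.log (a x t / q t)) - β * ∑ x, p x * ∑ t, a x t * S x t
      = ∑ x, p x * ∑ t, a x t * Real.log (a x t / (q t * Real.exp (β * S x t))) := by
  rw [mul_sum, ← sum_sub_distrib]
  refine sum_congr rfl fun x _ => ?_
  rw [mul_left_comm, ← mul_sub, mul_sum, ← sum_sub_distrib]
  congr 1
  refine sum_congr rfl fun t _ => ?_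
  rw [Real.log_div (ha x t).ne' (hq t).ne',
    Real.log_div (ha x t).ne' (mul_pos (hq t) (Real.exp_pos _)).ne',
    Real.log_mul (hq t).ne' (Real.exp_pos _).ne', Real.log_exp]
  ring

/-- Equality of the triple minimization of the IB Lagrangian (over `p(t|x)`, `q(t)`,
`r(y|t)`) with the double minimization of the dual functional `F(q,r)`. -/
theorem triple_min_eq_double_min
    {X Y T : Type*} [Fintype X] [Fintype Y] [Fintype T]
    (p : X → ℝ) (hp : ∀ x, 0 < p x) (hp1 : ∑ x, p x = 1)
    (pyx : X → Y → ℝ) (hpyx : ∀ x, (∀ y, 0 ≤ pyx x y) ∧ ∑ y, pyx x y = 1)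
    (β : ℝ) (hβ : 0 < β) :
    sInf {v : ℝ | ∃ (ptx : X → T → ℝ) (q : T → ℝ) (r : Y → T → ℝ),
        (∀ x t, 0 < ptx x t) ∧ (∀ x, ∑ t, ptx x t = 1) ∧
        (∀ t, 0 < q t) ∧ (∑ t, q t = 1) ∧
        (∀ y t, 0 < r y t) ∧ (∀ t, ∑ y, r y t = 1) ∧
        v = (∑ x, p x * ∑ t, ptx x t * Real.log (ptx x t / q t)) -
              β * ∑ x, p x * ∑ t, ptx x t * ∑ y, pyx x y * Real.log (r y t)}
      = sInf {v : ℝ | ∃ (q : T → ℝ) (r : Y → T → ℝ),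
        (∀ t, 0 < q t) ∧ (∑ t, q t = 1) ∧
        (∀ y t, 0 < r y t) ∧ (∀ t, ∑ y, r y t = 1) ∧
        v = -∑ x, p x * Real.log (∑ t, q t *
              Real.exp (β * ∑ y, pyx x y * Real.log (r y t)))} := by
  have hw : ∀ (q : T → ℝ) (r : Y → T → ℝ), (∀ t, 0 < q t) → ∀ x t,
      0 < q t * Real.exp (β * ∑ y, pyx x y * Real.log (r y t)) :=
    fun q r hq x t => mul_pos (hq t) (Real.exp_pos _)
  apply csInf_eq_csInf_of_forall_exists_le
  · rintro _ ⟨a, q, r, ha, ha1, hq, hq1, hr, hr1, rfl⟩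
    refine ⟨_, ⟨q, r, hq, hq1, hr, hr1, rfl⟩, ?_⟩
    rw [sum_mul_log_sub_eq_sum_mul_log_div_mul_exp p β _ ha hq, ← sum_neg_distrib]
    refine sum_le_sum fun x _ => ?_
    rw [← mul_neg]
    exact mul_le_mul_of_nonneg_left
      (neg_log_sum_le_sum_mul_log_div (ha x) (ha1 x) (hw q r hq x)) (hp x).le
  · rintro _ ⟨q, r, hq, hq1, hr, hr1, rfl⟩
    have hT : Nonempty T := by
      by_contra h
      rw [not_nonempty_iff] at h
      simp at hq1
    have hZ := fun x => sum_pos (fun t _ => hw q r hq x t) univ_nonempty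
    have ha := fun x t => div_pos (hw q r hq x t) (hZ x)
    refine ⟨_, ⟨_, q, r, ha, fun x => ?_, hq, hq1, hr, hr1, rfl⟩, le_of_eq ?_⟩
    · rw [← sum_div, div_self (hZ x).ne']
    · rw [sum_mul_log_sub_eq_sum_mul_log_div_mul_exp p β _ ha hq, ← sum_neg_distrib]
      refine sum_congr rfl fun x _ => ?_
      rw [← mul_neg, sum_normalized_mul_log_div (hw q r hq x)]
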